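/- arXiv:2510.11477 — 2 statements merged into one kernel-verified Lean document; each statement's English description precedes it below -/
import Mathlib

section
/- Let p be an odd prime, r ≥ 1, and let T be a symmetric r×r matrix over ℤ_p with det T ≠ 0; write B(x,y) = xᵀ·T·y for the associated bilinear form on ℤ_p^r and set N = v_p(det T). Then every ℤ_p-linear automorphism σ of ℤ_p^r satisfying B(σx, σy) = B(x,y) for all x, y and det σ = 1 can be written, as a linear automorphism of ℚ_p^r, as a composition of an even number n ≤ 2r of reflections τ_{b₁} ∘ ⋯ ∘ τ_{b_n}, where each b_j ∈ ℤ_p^r satisfies B(b_j, b_j) ≠ 0 and v_p(B(b_j, b_j)) ≤ N, and τ_b denotes the reflection τ_b(x) = x − (2·B(b,x)/B(b,b))·b of ℚ_p^r. In particular the sum of the valuations ∑_j v_p(B(b_j, b_j)) is at most 2rN. -/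
open Matrix

noncomputable section

/-- The bilinear form `B(x,y) = xᵀ · T · y` on `ℤ_p ^ r` associated to a Gram matrix `T`. -/
def padicBilin (p : ℕ) [Fact p.Prime] {r : ℕ} (T : Matrix (Fin r) (Fin r) ℤ_[p])
    (x y : Fin r → ℤ_[p]) : ℤ_[p] :=
  x ⬝ᵥ T.mulVec y

/-- The reflection `τ_b(x) = x − (2·B(b,x)/B(b,b))·b` of `ℚ_p ^ r` in an integral vector
`b`, for the bilinear form with Gram matrix `T`, as an element of `Function.End`
(so that products of lists of reflections are compositions). -/
def padicReflection (p : ℕ) [Fact p.Prime] {r : ℕ} (T : Matrix (Fin r) (Fin r) ℤ_[p])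
    (b : Fin r → ℤ_[p]) : Function.End (Fin r → ℚ_[p]) :=
  fun x =>
    x - (2 * ((fun i => (b i : ℚ_[p])) ⬝ᵥ (T.map fun t : ℤ_[p] => (t : ℚ_[p])).mulVec x) /
          ((fun i => (b i : ℚ_[p])) ⬝ᵥ (T.map fun t : ℤ_[p] => (t : ℚ_[p])).mulVec
            fun i => (b i : ℚ_[p]))) • fun i => (b i : ℚ_[p])

section Helpers

variable {p : ℕ} [Fact p.Prime] {r : ℕ}

theorem bil_add_left (T : Matrix (Fin r) (Fin r) ℤ_[p]) (x y z : Fin r → ℤ_[p]) :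
    padicBilin p T (x + y) z = padicBilin p T x z + padicBilin p T y z := by
  simp [padicBilin, add_dotProduct]

theorem bil_add_right (T : Matrix (Fin r) (Fin r) ℤ_[p]) (x y z : Fin r → ℤ_[p]) :
    padicBilin p T x (y + z) = padicBilin p T x y + padicBilin p T x z := by
  simp [padicBilin, Matrix.mulVec_add, dotProduct_add]

theorem bil_sub_left (T : Matrix (Fin r) (Fin r) ℤ_[p]) (x y z : Fin r → ℤ_[p]) :
    padicBilin p T (x - y) z = padicBilin p T x z - padicBilin p T y z := by
  simp [padicBilin, sub_dotProduct]

theorem bil_sub_right (T : Matrix (Fin r) (Fin r) ℤ_[p]) (x y z : Fin r → ℤ_[p]) :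
    padicBilin p T x (y - z) = padicBilin p T x y - padicBilin p T x z := by
  simp [padicBilin, Matrix.mulVec_sub, dotProduct_sub]

theorem bil_smul_left (T : Matrix (Fin r) (Fin r) ℤ_[p]) (c : ℤ_[p]) (x y : Fin r → ℤ_[p]) :
    padicBilin p T (c • x) y = c * padicBilin p T x y := by
  simp [padicBilin]

theorem bil_smul_right (T : Matrix (Fin r) (Fin r) ℤ_[p]) (c : ℤ_[p]) (x y : Fin r → ℤ_[p]) :
    padicBilin p T x (c • y) = c * padicBilin p T x y := by
  simp [padicBilin, Matrix.mulVec_smul]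

theorem bil_symm {T : Matrix (Fin r) (Fin r) ℤ_[p]} (hT : T.IsSymm) (x y : Fin r → ℤ_[p]) :
    padicBilin p T x y = padicBilin p T y x := by
  unfold padicBilin
  rw [dotProduct_comm, ← Matrix.dotProduct_transpose_mulVec, hT.eq, dotProduct_comm]

theorem bil_nondeg {T : Matrix (Fin r) (Fin r) ℤ_[p]} (hdet : T.det ≠ 0)
    {x : Fin r → ℤ_[p]} (h : ∀ y, padicBilin p T y x = 0) : x = 0 := by
  apply Matrix.eq_zero_of_mulVec_eq_zero hdet
  funext i
  have := h (Pi.single i 1)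
  simpa [padicBilin] using this

theorem bil_single (T : Matrix (Fin r) (Fin r) ℤ_[p]) (b : Fin r → ℤ_[p]) (i : Fin r) :
    padicBilin p T b (Pi.single i 1) = (b ᵥ* T) i := by
  rw [padicBilin, Matrix.dotProduct_mulVec, dotProduct_single_one]

theorem two_isUnit (hp : p ≠ 2) : IsUnit (2 : ℤ_[p]) := by
  have h : IsUnit ((2 : ℕ) : ℤ_[p]) := by
    rw [PadicInt.isUnit_iff]
    have := (PadicInt.norm_natCast_eq_one_iff (p := p) (n := 2)).2
      ((Nat.coprime_primes Fact.out Nat.prime_two).2 hp)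
    exact this
  simpa using h

/-- The pair `(b,w)` encodes a reflection defined over `ℤ_p`. -/
def Good (T : Matrix (Fin r) (Fin r) ℤ_[p]) (q : (Fin r → ℤ_[p]) × (Fin r → ℤ_[p])) : Prop :=
  padicBilin p T q.1 q.1 ≠ 0 ∧
    ∀ x, padicBilin p T q.1 q.1 * (q.2 ⬝ᵥ x) = 2 * padicBilin p T q.1 x

/-- The matrix of the reflection. -/
def rmat (q : (Fin r → ℤ_[p]) × (Fin r → ℤ_[p])) : Matrix (Fin r) (Fin r) ℤ_[p] :=
  1 - Matrix.vecMulVec q.1 q.2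

theorem rmat_mulVec (q : (Fin r → ℤ_[p]) × (Fin r → ℤ_[p])) (x : Fin r → ℤ_[p]) :
    (rmat q).mulVec x = x - (q.2 ⬝ᵥ x) • q.1 := by
  simp [rmat, Matrix.sub_mulVec, Matrix.vecMulVec_mulVec]

theorem Good.self {T : Matrix (Fin r) (Fin r) ℤ_[p]} {q} (h : Good T q) : q.2 ⬝ᵥ q.1 = 2 := by
  have := h.2 q.1
  rw [mul_comm 2] at this
  exact mul_left_cancel₀ h.1 this

theorem Good.det {T : Matrix (Fin r) (Fin r) ℤ_[p]} {q} (h : Good T q) : (rmat q).det = -1 := by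
  have e : rmat q = 1 + Matrix.replicateCol Unit (-q.1) * Matrix.replicateRow Unit q.2 := by
    ext i j
    simp [rmat, Matrix.vecMulVec_apply, Matrix.mul_apply, sub_eq_add_neg]
  rw [e, Matrix.det_one_add_replicateCol_mul_replicateRow, dotProduct_neg, h.self]
  norm_num

theorem Good.sq {T : Matrix (Fin r) (Fin r) ℤ_[p]} {q} (h : Good T q) : rmat q * rmat q = 1 := by
  apply Matrix.toLin'.injective
  apply LinearMap.ext
  intro x
  simp only [Matrix.toLin'_apply, ← Matrix.mulVec_mulVec, rmat_mulVec, Matrix.one_mulVec,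
    dotProduct_sub, dotProduct_smul, h.self, smul_eq_mul]
  module

theorem Good.isom {T : Matrix (Fin r) (Fin r) ℤ_[p]} {q} (hT : T.IsSymm) (h : Good T q) (x y) :
    padicBilin p T ((rmat q).mulVec x) ((rmat q).mulVec y) = padicBilin p T x y := by
  simp only [rmat_mulVec, bil_sub_left, bil_sub_right, bil_smul_left, bil_smul_right]
  have hx := h.2 x
  have hy := h.2 y
  rw [bil_symm hT x q.1]
  have h2 : (2 : ℤ_[p]) ≠ 0 := two_ne_zero
  apply mul_left_cancel₀ h2
  linear_combination (q.2 ⬝ᵥ y) * hx + (q.2 ⬝ᵥ x) * hy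

theorem Good.dvd {T : Matrix (Fin r) (Fin r) ℤ_[p]} {q} (hp : p ≠ 2)
    (h : Good T q) : padicBilin p T q.1 q.1 ∣ T.det := by
  obtain ⟨b, w⟩ := q
  have hw : padicBilin p T b b • w = (2 : ℤ_[p]) • (b ᵥ* T) := by
    funext i
    have := h.2 (Pi.single i 1)
    rw [dotProduct_single_one, bil_single] at this
    simpa using this
  -- `2 det T • b = d • (w * adj T)`
  have h1 : (2 * T.det) • b = padicBilin p T b b • (w ᵥ* T.adjugate) := by
    rw [← Matrix.smul_vecMul, hw, Matrix.smul_vecMul, Matrix.vecMul_vecMul, Matrix.mul_adjugate,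
      Matrix.vecMul_smul, Matrix.vecMul_one, smul_smul]
  have h2 : w ⬝ᵥ ((2 * T.det) • b) = padicBilin p T b b * (w ⬝ᵥ (w ᵥ* T.adjugate)) := by
    rw [h1, dotProduct_smul, smul_eq_mul]
  have h3 : w ⬝ᵥ b = 2 := h.self
  rw [dotProduct_smul, smul_eq_mul, h3] at h2
  have hu := two_isUnit (p := p) hp
  have h4 : padicBilin p T b b ∣ (2 * 2) * T.det := ⟨_, by rw [← h2]; ring⟩
  exact ((hu.mul hu).dvd_mul_left).1 h4

theorem val_le_of_dvd {a b : ℤ_[p]} (hb : b ≠ 0) (h : a ∣ b) : a.valuation ≤ b.valuation := by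
  obtain ⟨c, rfl⟩ := h
  rw [PadicInt.valuation_mul (left_ne_zero_of_mul hb) (right_ne_zero_of_mul hb)]
  omega

theorem dvd_of_val_le {a b : ℤ_[p]} (ha : a ≠ 0) (h : b ≠ 0 → a.valuation ≤ b.valuation) :
    a ∣ b := by
  by_cases hb : b = 0
  · simp [hb]
  rw [PadicInt.unitCoeff_spec ha, PadicInt.unitCoeff_spec hb]
  exact (Units.mul_left_dvd.2 (dvd_mul_of_dvd_right (pow_dvd_pow _ (h hb)) _))

theorem good_exists {T : Matrix (Fin r) (Fin r) ℤ_[p]} {b : Fin r → ℤ_[p]}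
    (h0 : padicBilin p T b b ≠ 0) (h : ∀ x, padicBilin p T b b ∣ padicBilin p T b x) :
    ∃ w, Good T (b, w) := by
  choose g hg using fun i : Fin r => h (Pi.single i 1)
  refine ⟨(2 : ℤ_[p]) • g, h0, fun x => ?_⟩
  have hg' : b ᵥ* T = padicBilin p T b b • g := by
    funext i
    have := hg i
    rw [bil_single] at this
    simpa using this
  have : padicBilin p T b x = padicBilin p T b b * (g ⬝ᵥ x) := by
    conv_lhs => rw [padicBilin, Matrix.dotProduct_mulVec, hg', smul_dotProduct, smul_eq_mul]
  simp only [this, smul_dotProduct, smul_eq_mul]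
  ring

theorem exists_min {T : Matrix (Fin r) (Fin r) ℤ_[p]} (hp : p ≠ 2) (hT : T.IsSymm)
    (M : Submodule ℤ_[p] (Fin r → ℤ_[p]))
    (hM : ∃ x ∈ M, ∃ y ∈ M, padicBilin p T x y ≠ 0) :
    ∃ e ∈ M, padicBilin p T e e ≠ 0 ∧
      ∀ x ∈ M, ∀ y ∈ M, padicBilin p T e e ∣ padicBilin p T x y := by
  have pol : ∀ x y, 2 * padicBilin p T x y =
      padicBilin p T (x + y) (x + y) - padicBilin p T x x - padicBilin p T y y := by
    intro x y
    simp only [bil_add_left, bil_add_right, bil_symm hT y x]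
    ring
  have hne : {e : Fin r → ℤ_[p] | e ∈ M ∧ padicBilin p T e e ≠ 0}.Nonempty := by
    by_contra hcon
    rw [Set.not_nonempty_iff_eq_empty] at hcon
    have hz : ∀ x ∈ M, padicBilin p T x x = 0 := by
      intro x hx
      by_contra h
      have : x ∈ {e : Fin r → ℤ_[p] | e ∈ M ∧ padicBilin p T e e ≠ 0} := ⟨hx, h⟩
      rw [hcon] at this
      exact this
    obtain ⟨x, hx, y, hy, hxy⟩ := hM
    have := pol x y
    rw [hz _ hx, hz _ hy, hz _ (M.add_mem hx hy)] at this
    simp [hxy] at this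
  obtain ⟨e, ⟨heM, he0⟩, hmin⟩ := WellFounded.has_min
    (InvImage.wf (fun e : Fin r → ℤ_[p] => (padicBilin p T e e).valuation) Nat.lt_wfRel.wf) _ hne
  have hd : ∀ x ∈ M, padicBilin p T e e ∣ padicBilin p T x x := by
    intro x hx
    apply dvd_of_val_le he0
    intro h0
    exact not_lt.1 (hmin x ⟨hx, h0⟩)
  refine ⟨e, heM, he0, fun x hx y hy => ?_⟩
  apply ((two_isUnit (p := p) hp).dvd_mul_left).1
  rw [pol]
  exact dvd_sub (dvd_sub (hd _ (M.add_mem hx hy)) (hd _ hx)) (hd _ hy)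

/-- The functional `x ↦ B(e,x)`. -/
def bilFun (T : Matrix (Fin r) (Fin r) ℤ_[p]) (e : Fin r → ℤ_[p]) :
    (Fin r → ℤ_[p]) →ₗ[ℤ_[p]] ℤ_[p] where
  toFun x := padicBilin p T e x
  map_add' := bil_add_right T e
  map_smul' c x := by simp [bil_smul_right]

theorem finrank_step (M : Submodule ℤ_[p] (Fin r → ℤ_[p]))
    (f : (Fin r → ℤ_[p]) →ₗ[ℤ_[p]] ℤ_[p]) (e : Fin r → ℤ_[p]) (he : e ∈ M) (hfe : f e ≠ 0) :
    Module.finrank ℤ_[p] (M ⊓ LinearMap.ker f : Submodule ℤ_[p] (Fin r → ℤ_[p])) <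
      Module.finrank ℤ_[p] M := by
  have h1 := Submodule.rank_sup_add_rank_inf_eq (M ⊓ LinearMap.ker f) (ℤ_[p] ∙ e)
  simp only [← Module.finrank_eq_rank] at h1
  norm_cast at h1
  have h2 : (M ⊓ LinearMap.ker f) ⊓ (ℤ_[p] ∙ e) = ⊥ := by
    rw [eq_bot_iff]
    rintro x ⟨⟨-, hx⟩, hx'⟩
    obtain ⟨c, rfl⟩ := Submodule.mem_span_singleton.1 hx'
    have : c * f e = 0 := by simpa using hx
    have : c = 0 := by simpa [hfe] using this
    simp [this]
  have h3 : (M ⊓ LinearMap.ker f) ⊔ (ℤ_[p] ∙ e) ≤ M :=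
    sup_le inf_le_left ((Submodule.span_singleton_le_iff_mem _ _).2 he)
  have h4 := Submodule.finrank_mono h3
  have h5 : Module.finrank ℤ_[p] (ℤ_[p] ∙ e) ≠ 0 := by
    rw [Ne, Submodule.finrank_eq_zero, Submodule.span_singleton_eq_bot]
    rintro rfl
    simp at hfe
  rw [h2, finrank_bot] at h1
  omega

theorem main_induction {T : Matrix (Fin r) (Fin r) ℤ_[p]} (hp : p ≠ 2) (hT : T.IsSymm)
    (hdet : T.det ≠ 0) (n : ℕ) :
    ∀ (F M : Submodule ℤ_[p] (Fin r → ℤ_[p])) (S : Matrix (Fin r) (Fin r) ℤ_[p]),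
      Module.finrank ℤ_[p] M ≤ n → F ⊔ M = ⊤ →
      (∀ f ∈ F, ∀ m ∈ M, padicBilin p T f m = 0) →
      (∀ x y, padicBilin p T (S.mulVec x) (S.mulVec y) = padicBilin p T x y) →
      (∀ f ∈ F, S.mulVec f = f) →
      ∃ l : List ((Fin r → ℤ_[p]) × (Fin r → ℤ_[p])), l.length ≤ 2 * n ∧
        (∀ q ∈ l, Good T q) ∧ S = (l.map rmat).prod := by
  induction n with
  | zero =>
    intro F M S hn hFM _ _ hfix
    have hM : M = ⊥ := Submodule.finrank_eq_zero.1 (Nat.le_zero.1 hn)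
    refine ⟨[], by simp, by simp, ?_⟩
    rw [hM, sup_bot_eq] at hFM
    apply Matrix.toLin'.injective
    apply LinearMap.ext
    intro x
    simpa using hfix x (by rw [hFM]; trivial)
  | succ n ih =>
    intro F M S hn hFM horth hiso hfix
    have hdec : ∀ x, ∃ f ∈ F, ∃ m ∈ M, f + m = x := fun x =>
      Submodule.mem_sup.1 (by rw [hFM]; trivial)
    by_cases hM : M = ⊥
    · exact (ih F M S (by rw [hM, finrank_bot]; omega) hFM horth hiso hfix).imp
        fun l hl => ⟨by omega, hl.2⟩
    obtain ⟨e, heM, he0, hmin⟩ := exists_min (T := T) hp hT M (by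
      obtain ⟨x, hxM, hx0⟩ := (Submodule.ne_bot_iff _).1 hM
      by_contra hcon
      push Not at hcon
      apply hx0
      apply bil_nondeg hdet
      intro y
      obtain ⟨f, hf, m, hm, rfl⟩ := hdec y
      rw [bil_add_left, horth f hf x hxM, hcon m hm x hxM, add_zero])
    -- `S` preserves `M`
    have hSM : ∀ x ∈ M, S.mulVec x ∈ M := by
      intro x hx
      obtain ⟨f, hf, m, hm, hfm⟩ := hdec (S.mulVec x)
      have hf0 : f = 0 := by
        apply bil_nondeg hdet
        intro y
        obtain ⟨f', hf', m', hm', rfl⟩ := hdec y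
        rw [bil_add_left, bil_symm hT m' f, horth f hf m' hm', add_zero]
        have h1 := hiso f' x
        rw [hfix f' hf', horth f' hf' x hx, ← hfm, bil_add_right, horth f' hf' m hm,
          add_zero] at h1
        exact h1
      rw [← hfm, hf0, zero_add]
      exact hm
    have hdvd : ∀ b ∈ M, ∀ x, padicBilin p T e e ∣ padicBilin p T b x := by
      intro b hb x
      obtain ⟨f, hf, m, hm, rfl⟩ := hdec x
      rw [bil_add_right, bil_symm hT b f, horth f hf b hb, zero_add]
      exact hmin b hb m hm
    have hgood : ∀ b ∈ M, ∀ u : ℤ_[p], IsUnit u →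
        padicBilin p T b b = padicBilin p T e e * u → ∃ w, Good T (b, w) := by
      intro b hb u hu h
      apply good_exists
      · rw [h]; exact mul_ne_zero he0 hu.ne_zero
      · intro x
        rw [h, hu.mul_right_dvd]
        exact hdvd b hb x
    have hgfix : ∀ q, Good T q → q.1 ∈ M → ∀ f ∈ F, (rmat q).mulVec f = f := by
      intro q hq hqM f hf
      have h1 := hq.2 f
      rw [bil_symm hT q.1 f, horth f hf _ hqM, mul_zero] at h1
      have h2 : q.2 ⬝ᵥ f = 0 := (mul_eq_zero.1 h1).resolve_left hq.1
      rw [rmat_mulVec, h2, zero_smul, sub_zero]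
    -- the key step
    have key : ∃ k : List ((Fin r → ℤ_[p]) × (Fin r → ℤ_[p])), k.length ≤ 2 ∧
        (∀ q ∈ k, Good T q ∧ q.1 ∈ M) ∧ ((k.map rmat).prod).mulVec (S.mulVec e) = e := by
      set v := S.mulVec e with hv
      have hvM : v ∈ M := hSM e heM
      have hvv : padicBilin p T v v = padicBilin p T e e := hiso e e
      obtain ⟨c, hc⟩ := hmin v hvM e heM
      have hu2 := two_isUnit (p := p) hp
      have hsum : IsUnit ((1 - c) + (1 + c)) := by
        have : (1 - c) + (1 + c) = 2 := by ring
        rw [this]; exact hu2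
      rcases IsLocalRing.isUnit_or_isUnit_of_isUnit_add hsum with hu | hu
      · have hbb : padicBilin p T (v - e) (v - e) = padicBilin p T e e * (2 * (1 - c)) := by
          simp only [bil_sub_left, bil_sub_right, hvv, bil_symm hT e v, hc]; ring
        obtain ⟨w, hw⟩ := hgood (v - e) (M.sub_mem hvM heM) _ (hu2.mul hu) hbb
        refine ⟨[(v - e, w)], by simp, by simpa using ⟨hw, M.sub_mem hvM heM⟩, ?_⟩
        have h1 : w ⬝ᵥ v = 1 := by
          apply mul_left_cancel₀ hw.1
          rw [hw.2 v]
          simp only [hbb, bil_sub_left, hvv, bil_symm hT e v, hc]; ring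
        simp [rmat_mulVec, h1]
      · have hbb : padicBilin p T (v + e) (v + e) = padicBilin p T e e * (2 * (1 + c)) := by
          simp only [bil_add_left, bil_add_right, hvv, bil_symm hT e v, hc]; ring
        obtain ⟨w, hw⟩ := hgood (v + e) (M.add_mem hvM heM) _ (hu2.mul hu) hbb
        obtain ⟨w', hw'⟩ := hgood e heM 1 isUnit_one (by ring)
        refine ⟨[(e, w'), (v + e, w)], by simp, by
          simpa using ⟨⟨hw', heM⟩, hw, M.add_mem hvM heM⟩, ?_⟩
        have h1 : w ⬝ᵥ v = 1 := by
          apply mul_left_cancel₀ hw.1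
          rw [hw.2 v]
          simp only [hbb, bil_add_left, hvv, bil_symm hT e v, hc]; ring
        have h2 : w' ⬝ᵥ e = 2 := hw'.self
        have h3 : (rmat (v + e, w)).mulVec v = -e := by
          rw [rmat_mulVec]; simp [h1]
        simp only [List.map_cons, List.map_nil, List.prod_cons, List.prod_nil, mul_one,
          ← Matrix.mulVec_mulVec]
        rw [h3, rmat_mulVec]
        simp only [dotProduct_neg, h2]
        module
    obtain ⟨k, hk2, hkg, hke⟩ := key
    -- properties of the product
    have hkprop : ∀ k : List ((Fin r → ℤ_[p]) × (Fin r → ℤ_[p])),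
        (∀ q ∈ k, Good T q ∧ q.1 ∈ M) →
        (∀ x y, padicBilin p T (((k.map rmat).prod).mulVec x) (((k.map rmat).prod).mulVec y)
          = padicBilin p T x y) ∧ (∀ f ∈ F, ((k.map rmat).prod).mulVec f = f) ∧
          ((k.reverse.map rmat).prod) * (k.map rmat).prod = 1 := by
      intro k
      induction k with
      | nil => intro _; simp
      | cons q k ihk =>
        intro h
        obtain ⟨h1, h2, h3⟩ := ihk fun q' hq' => h q' (List.mem_cons_of_mem _ hq')
        obtain ⟨hq, hqM⟩ := h q List.mem_cons_self
        refine ⟨fun x y => ?_, fun f hf => ?_, ?_⟩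
        · simp only [List.map_cons, List.prod_cons, ← Matrix.mulVec_mulVec]
          rw [hq.isom hT, h1]
        · simp only [List.map_cons, List.prod_cons, ← Matrix.mulVec_mulVec]
          rw [h2 f hf, hgfix q hq hqM f hf]
        · simp only [List.reverse_cons, List.map_append, List.map_cons, List.map_nil,
            List.prod_append, List.prod_cons, List.prod_nil, mul_one]
          rw [mul_assoc, ← mul_assoc (rmat q), hq.sq, one_mul, h3]
    obtain ⟨k1, k2, k3⟩ := hkprop k hkg
    obtain ⟨l, hl1, hl2, hl3⟩ := ih (F ⊔ (ℤ_[p] ∙ e)) (M ⊓ LinearMap.ker (bilFun T e))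
      ((k.map rmat).prod * S)
      (by
        have := finrank_step M (bilFun T e) e heM he0
        omega)
      (by
        rw [eq_top_iff]
        rintro x -
        obtain ⟨f, hf, m, hm, rfl⟩ := hdec x
        obtain ⟨c, hc⟩ := hdvd e heM m
        have : f + m = (f + c • e) + (m - c • e) := by abel
        rw [this]
        apply Submodule.add_mem_sup
        · exact Submodule.add_mem_sup hf
            (Submodule.smul_mem _ _ (Submodule.mem_span_singleton_self e))
        · refine ⟨M.sub_mem hm (M.smul_mem _ heM), ?_⟩
          change padicBilin p T e (m - c • e) = 0
          rw [bil_sub_right, bil_smul_right, hc]; ring)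
      (by
        rintro f hf m ⟨hm, hm'⟩
        have hm'' : padicBilin p T e m = 0 := hm'
        obtain ⟨f, hfF, g, hg, rfl⟩ := Submodule.mem_sup.1 hf
        obtain ⟨c, rfl⟩ := Submodule.mem_span_singleton.1 hg
        rw [bil_add_left, bil_smul_left, hm'', horth f hfF m hm]; ring)
      (by
        intro x y
        rw [← Matrix.mulVec_mulVec, ← Matrix.mulVec_mulVec, k1, hiso])
      (by
        intro f hf
        obtain ⟨f, hfF, g, hg, rfl⟩ := Submodule.mem_sup.1 hf
        obtain ⟨c, rfl⟩ := Submodule.mem_span_singleton.1 hg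
        rw [← Matrix.mulVec_mulVec, Matrix.mulVec_add, Matrix.mulVec_add, hfix f hfF, k2 f hfF,
          Matrix.mulVec_smul, Matrix.mulVec_smul, hke])
    refine ⟨k.reverse ++ l, ?_, ?_, ?_⟩
    · simp only [List.length_append, List.length_reverse]; omega
    · intro q hq
      rcases List.mem_append.1 hq with h | h
      · exact (hkg q (List.mem_reverse.1 h)).1
      · exact hl2 q h
    · rw [List.map_append, List.prod_append, ← hl3, ← mul_assoc, k3, one_mul]

theorem Good.cast {T : Matrix (Fin r) (Fin r) ℤ_[p]} {q} (h : Good T q) (x : Fin r → ℚ_[p]) :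
    ((rmat q).map fun t : ℤ_[p] => (t : ℚ_[p])).mulVec x = padicReflection p T q.1 x := by
  obtain ⟨b, w⟩ := q
  have h0 : ((padicBilin p T b b : ℤ_[p]) : ℚ_[p]) ≠ 0 := by
    simpa using h.1
  have hbb : ((fun i => (b i : ℚ_[p])) ⬝ᵥ (T.map fun t : ℤ_[p] => (t : ℚ_[p])).mulVec
            fun i => (b i : ℚ_[p])) = ((padicBilin p T b b : ℤ_[p]) : ℚ_[p]) := by
    simp [padicBilin, dotProduct, Matrix.mulVec]
  have hw : ∀ i, ((padicBilin p T b b : ℤ_[p]) : ℚ_[p]) * (w i : ℚ_[p]) =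
      2 * ((fun i => (b i : ℚ_[p])) ᵥ* (T.map fun t : ℤ_[p] => (t : ℚ_[p]))) i := by
    intro i
    have h1 := h.2 (Pi.single i 1)
    have h2 : padicBilin p T b b * w i = 2 * (b ᵥ* T) i := by
      rw [dotProduct_single_one, bil_single] at h1
      simpa using h1
    have h3 := congrArg (fun t : ℤ_[p] => (t : ℚ_[p])) h2
    have h4 : ((2 : ℤ_[p]) : ℚ_[p]) = 2 := rfl
    simpa [Matrix.vecMul, dotProduct, h4] using h3
  have hwx : 2 * ((fun i => (b i : ℚ_[p])) ⬝ᵥ (T.map fun t : ℤ_[p] => (t : ℚ_[p])).mulVec x) =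
      ((padicBilin p T b b : ℤ_[p]) : ℚ_[p]) * ((fun i => (w i : ℚ_[p])) ⬝ᵥ x) := by
    rw [Matrix.dotProduct_mulVec]
    simp only [dotProduct, Finset.mul_sum, ← mul_assoc, hw]
  have hm : ((rmat (b, w)).map fun t : ℤ_[p] => (t : ℚ_[p])) =
      1 - Matrix.vecMulVec (fun i => (b i : ℚ_[p])) (fun i => (w i : ℚ_[p])) := by
    ext i j
    by_cases hij : i = j <;> simp [rmat, Matrix.vecMulVec_apply, hij]
  unfold padicReflection
  rw [hm, hbb, hwx, mul_div_cancel_left₀ _ h0]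
  simp [Matrix.sub_mulVec, Matrix.vecMulVec_mulVec]

theorem prod_cast {T : Matrix (Fin r) (Fin r) ℤ_[p]}
    (l : List ((Fin r → ℤ_[p]) × (Fin r → ℤ_[p]))) (h : ∀ q ∈ l, Good T q)
    (x : Fin r → ℚ_[p]) :
    (((l.map rmat).prod).map fun t : ℤ_[p] => (t : ℚ_[p])).mulVec x =
      (l.map fun q => padicReflection p T q.1).prod x := by
  induction l with
  | nil =>
    have : ((1 : Matrix (Fin r) (Fin r) ℤ_[p]).map fun t : ℤ_[p] => (t : ℚ_[p])) = 1 :=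
      Matrix.map_one _ (by simp) (by simp)
    simp only [List.map_nil, List.prod_nil, this, Matrix.one_mulVec]
    rfl
  | cons q l ih =>
    have hmul : ∀ A C : Matrix (Fin r) (Fin r) ℤ_[p],
        ((A * C).map fun t : ℤ_[p] => (t : ℚ_[p])) =
        (A.map fun t : ℤ_[p] => (t : ℚ_[p])) * (C.map fun t : ℤ_[p] => (t : ℚ_[p])) := fun A C =>
      Matrix.map_mul (f := PadicInt.Coe.ringHom)
    simp only [List.map_cons, List.prod_cons]
    rw [hmul, ← Matrix.mulVec_mulVec, ih fun q' hq' => h q' (List.mem_cons_of_mem _ hq'),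
      (h q List.mem_cons_self).cast]
    rfl

theorem prod_det {T : Matrix (Fin r) (Fin r) ℤ_[p]}
    (l : List ((Fin r → ℤ_[p]) × (Fin r → ℤ_[p]))) (h : ∀ q ∈ l, Good T q) :
    ((l.map rmat).prod).det = (-1) ^ l.length := by
  induction l with
  | nil => simp
  | cons q l ih =>
    rw [List.map_cons, List.prod_cons, Matrix.det_mul,
      ih fun q' hq' => h q' (List.mem_cons_of_mem _ hq'), (h q List.mem_cons_self).det,
      List.length_cons, pow_succ, mul_comm]

end Helpers

/-- **Bounded Cartan–Dieudonné over `ℤ_p`, `p` odd** (Lemma on lifting to GSpin, odd case).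
Let `p` be an odd prime and `T` a nondegenerate symmetric `r × r` Gram matrix over `ℤ_p`
with `v_p(det T) = N`.  Every special isometry `σ ∈ SO(L)` (a `ℤ_p`-matrix `S` with unit
determinant, `Sᵀ T S = T` and `det S = 1`) is, as an automorphism of `ℚ_p ^ r`, a
composition of an even number `n ≤ 2r` of reflections `τ_{b_j}` in integral vectors `b_j`
with `B(b_j,b_j) ≠ 0` and `v_p(B(b_j,b_j)) ≤ N`; in particular
`∑ j, v_p(B(b_j,b_j)) ≤ 2rN`. -/
theorem isometry_eq_prod_reflections_bounded_valuation_odd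
    (p : ℕ) [Fact p.Prime] (hp : p ≠ 2) (r : ℕ) (hr : 1 ≤ r)
    (T : Matrix (Fin r) (Fin r) ℤ_[p]) (hTsymm : T.IsSymm) (hTdet : T.det ≠ 0)
    (N : ℕ) (hN : T.det.valuation = (N : ℤ))
    (S : Matrix (Fin r) (Fin r) ℤ_[p]) (hSunit : IsUnit S.det)
    (hSorth : Sᵀ * T * S = T) (hSdet : S.det = 1) :
    ∃ (n : ℕ) (b : Fin n → Fin r → ℤ_[p]),
      Even n ∧ n ≤ 2 * r ∧
      (∀ j, padicBilin p T (b j) (b j) ≠ 0) ∧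
      (∀ j, (padicBilin p T (b j) (b j)).valuation ≤ (N : ℤ)) ∧
      (∑ j, (padicBilin p T (b j) (b j)).valuation) ≤ 2 * r * N ∧
      ∀ x : Fin r → ℚ_[p],
        (S.map fun t : ℤ_[p] => (t : ℚ_[p])).mulVec x =
          (List.ofFn fun j => padicReflection p T (b j)).prod x := by
  obtain ⟨l, hl1, hl2, hl3⟩ := main_induction hp hTsymm hTdet r ⊥ ⊤ S (by simp) (by simp)
    (by
      intro f hf m _
      rw [(Submodule.mem_bot _).1 hf]
      simp [padicBilin])
    (by
      intro x y
      unfold padicBilin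
      conv_rhs => rw [← hSorth, ← Matrix.mulVec_mulVec, ← Matrix.mulVec_mulVec]
      rw [Matrix.dotProduct_transpose_mulVec, dotProduct_comm])
    (by
      intro f hf
      rw [(Submodule.mem_bot _).1 hf]
      simp)
  have hN' : T.det.valuation = N := by exact_mod_cast hN
  have hval : ∀ q ∈ l, (padicBilin p T q.1 q.1).valuation ≤ N := fun q hq =>
    hN' ▸ val_le_of_dvd hTdet ((hl2 q hq).dvd hp)
  refine ⟨l.length, fun j => (l.get j).1, ?_, hl1, fun j => (hl2 _ (l.get_mem j)).1,
    fun j => by exact_mod_cast hval _ (l.get_mem j), ?_, ?_⟩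
  · by_contra hodd
    rw [Nat.not_even_iff_odd] at hodd
    have h1 := prod_det l hl2
    rw [← hl3, hSdet, hodd.neg_one_pow] at h1
    have h2 : (2 : ℤ_[p]) = 0 := by linear_combination h1
    exact two_ne_zero h2
  · calc (∑ j : Fin l.length, (padicBilin p T (l.get j).1 (l.get j).1).valuation)
        ≤ ∑ _j : Fin l.length, N := Finset.sum_le_sum fun j _ => hval _ (l.get_mem j)
      _ = l.length * N := by simp
      _ ≤ 2 * r * N := Nat.mul_le_mul_right _ hl1
  · intro x
    have h1 := prod_cast l hl2 x
    rw [← hl3] at h1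
    rw [h1]
    have h2 : (l.map fun q => padicReflection p T q.1) =
        List.ofFn fun j : Fin l.length => padicReflection p T (l.get j).1 := by
      apply List.ext_getElem <;> simp
    rw [h2]

end
end

section
/- Let T be a symmetric 3×3 matrix over ℤ₂ with det T ≠ 0; write B(x,y) = xᵀ·T·y for the associated bilinear form on ℤ₂³ and set N = v₂(det T). Then every ℤ₂-linear automorphism σ of ℤ₂³ satisfying B(σx, σy) = B(x,y) for all x, y can be written, as a linear automorphism of ℚ₂³, as a composition of finitely many reflections τ_{b₁} ∘ ⋯ ∘ τ_{b_n}, where each b_j ∈ ℤ₂³ satisfies B(b_j, b_j) ≠ 0 and the total valuation satisfies ∑_{j=1}^{n} v₂(B(b_j, b_j)) ≤ 5N + 11; here τ_b denotes the reflection τ_b(x) = x − (2·B(b,x)/B(b,b))·b of ℚ₂³. -/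
open Matrix

noncomputable section

/-- The bilinear form `B(x,y) = xᵀ · T · y` on `ℤ₂ ^ 3` associated to a Gram matrix `T`. -/
def dyadicBilin (T : Matrix (Fin 3) (Fin 3) ℤ_[2]) (x y : Fin 3 → ℤ_[2]) : ℤ_[2] :=
  x ⬝ᵥ T.mulVec y

/-- The reflection `τ_b(x) = x − (2·B(b,x)/B(b,b))·b` of `ℚ₂ ^ 3` in an integral vector
`b`, for the bilinear form with Gram matrix `T`, as an element of `Function.End`
(so that products of lists of reflections are compositions). -/
def dyadicReflection (T : Matrix (Fin 3) (Fin 3) ℤ_[2]) (b : Fin 3 → ℤ_[2]) :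
    Function.End (Fin 3 → ℚ_[2]) :=
  fun x =>
    x - (2 * ((fun i => (b i : ℚ_[2])) ⬝ᵥ (T.map fun t : ℤ_[2] => (t : ℚ_[2])).mulVec x) /
          ((fun i => (b i : ℚ_[2])) ⬝ᵥ (T.map fun t : ℤ_[2] => (t : ℚ_[2])).mulVec
            fun i => (b i : ℚ_[2]))) • fun i => (b i : ℚ_[2])

/-! ### Part 1: orthogonal vectors of small norm in the lattice -/

section Lattice

variable {T : Matrix (Fin 3) (Fin 3) ℤ_[2]}

theorem dB_add_left (x y z : Fin 3 → ℤ_[2]) :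
    dyadicBilin T (x + y) z = dyadicBilin T x z + dyadicBilin T y z := by
  simp [dyadicBilin, add_dotProduct]

theorem dB_sub_left (x y z : Fin 3 → ℤ_[2]) :
    dyadicBilin T (x - y) z = dyadicBilin T x z - dyadicBilin T y z := by
  simp [dyadicBilin, sub_dotProduct]

theorem dB_smul_left (c : ℤ_[2]) (x z : Fin 3 → ℤ_[2]) :
    dyadicBilin T (c • x) z = c * dyadicBilin T x z := by
  simp [dyadicBilin, smul_dotProduct]

theorem dB_add_right (x y z : Fin 3 → ℤ_[2]) :
    dyadicBilin T z (x + y) = dyadicBilin T z x + dyadicBilin T z y := by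
  simp [dyadicBilin, dotProduct_add, mulVec_add]

theorem dB_sub_right (x y z : Fin 3 → ℤ_[2]) :
    dyadicBilin T z (x - y) = dyadicBilin T z x - dyadicBilin T z y := by
  simp [dyadicBilin, dotProduct_sub, mulVec_sub]

theorem dB_smul_right (c : ℤ_[2]) (x z : Fin 3 → ℤ_[2]) :
    dyadicBilin T z (c • x) = c * dyadicBilin T z x := by
  simp [dyadicBilin, dotProduct_smul, mulVec_smul]

theorem dB_comm (hT : T.IsSymm) (x y : Fin 3 → ℤ_[2]) :
    dyadicBilin T x y = dyadicBilin T y x := by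
  unfold dyadicBilin
  rw [dotProduct_mulVec, ← mulVec_transpose, hT.eq, dotProduct_comm]

theorem unit_one_add_two_mul (x : ℤ_[2]) : IsUnit (1 + 2 * x) := by
  by_contra h
  rw [PadicInt.not_isUnit_iff, PadicInt.norm_lt_one_iff_dvd] at h
  have h2 : ((2 : ℕ) : ℤ_[2]) ∣ 1 := by
    have h3 : ((2 : ℕ) : ℤ_[2]) ∣ 2 * x := Dvd.intro _ (by push_cast; rfl)
    exact (dvd_add_left h3).1 h
  have h4 := (PadicInt.norm_lt_one_iff_dvd (p := 2) 1).2 h2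
  simp at h4

theorem two_dvd_of_not_unit {x : ℤ_[2]} (h : ¬ IsUnit x) : (2 : ℤ_[2]) ∣ x := by
  rw [PadicInt.not_isUnit_iff, PadicInt.norm_lt_one_iff_dvd] at h
  exact_mod_cast h

theorem val_unit {x : ℤ_[2]} (h : IsUnit x) : x.valuation = 0 := by
  obtain ⟨y, hy⟩ := h.exists_right_inv
  have hx : x ≠ 0 := h.ne_zero
  have hy0 : y ≠ 0 := by rintro rfl; simp at hy
  have := PadicInt.valuation_mul hx hy0
  rw [hy, PadicInt.valuation_one] at this
  omega

theorem val_two : (2 : ℤ_[2]).valuation = 1 := by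
  have := PadicInt.valuation_p (p := 2)
  exact_mod_cast this

/-- If `a` does not divide `d` then `2 d` divides `a`. -/
theorem two_mul_dvd_of_not_dvd {a d : ℤ_[2]} (h : ¬ a ∣ d) : ∃ c, a = 2 * d * c := by
  rcases ValuationRing.dvd_total a d with h1 | ⟨c, rfl⟩
  · exact absurd h1 h
  · have hc : ¬ IsUnit c := by
      intro hc
      apply h
      obtain ⟨w, hw⟩ := hc.exists_right_inv
      exact ⟨w, by linear_combination (-d) * hw⟩
    obtain ⟨e, rfl⟩ := two_dvd_of_not_unit hc
    exact ⟨e, by ring⟩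

/-- The data we look for in a binary sublattice. -/
def PlaneGood (T : Matrix (Fin 3) (Fin 3) ℤ_[2]) (x y : Fin 3 → ℤ_[2]) (D : ℤ_[2]) : Prop :=
  ∃ p q r s : ℤ_[2],
    dyadicBilin T (p • x + q • y) (r • x + s • y) = 0 ∧
    dyadicBilin T (p • x + q • y) (p • x + q • y) ≠ 0 ∧
    dyadicBilin T (r • x + s • y) (r • x + s • y) ≠ 0 ∧
    2 * (dyadicBilin T (p • x + q • y) (p • x + q • y)).valuation
      + (dyadicBilin T (r • x + s • y) (r • x + s • y)).valuation ≤ 2 * D.valuation + 3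

theorem PlaneGood.swap {x y : Fin 3 → ℤ_[2]} {D : ℤ_[2]} (h : PlaneGood T y x D) :
    PlaneGood T x y D := by
  obtain ⟨p, q, r, s, h⟩ := h
  refine ⟨q, p, s, r, ?_⟩
  rwa [add_comm (q • x), add_comm (s • x)]

theorem PlaneGood.shear {x y : Fin 3 → ℤ_[2]} {D : ℤ_[2]} (h : PlaneGood T (x + y) y D) :
    PlaneGood T x y D := by
  obtain ⟨p, q, r, s, h⟩ := h
  refine ⟨p, p + q, r, r + s, ?_⟩
  have e : ∀ a b : ℤ_[2], a • (x + y) + b • y = a • x + (a + b) • y := by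
    intro a b; module
  rwa [e, e] at h

theorem planeGood_diag (hT : T.IsSymm) (x y : Fin 3 → ℤ_[2]) (D : ℤ_[2])
    (hD : D = dyadicBilin T x x * dyadicBilin T y y - dyadicBilin T x y ^ 2) (hD0 : D ≠ 0)
    (h : dyadicBilin T x x ∣ dyadicBilin T x y) : PlaneGood T x y D := by
  obtain ⟨k, hk⟩ := h
  have hc := dB_comm hT y x
  have e1 : dyadicBilin T ((1 : ℤ_[2]) • x + (0 : ℤ_[2]) • y) ((1 : ℤ_[2]) • x + (0 : ℤ_[2]) • y)
      = dyadicBilin T x x := by simp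
  have e2 : dyadicBilin T x x *
      dyadicBilin T ((-k) • x + (1 : ℤ_[2]) • y) ((-k) • x + (1 : ℤ_[2]) • y) = D := by
    rw [hD]
    simp only [dB_add_left, dB_add_right, dB_smul_left, dB_smul_right, hc, hk]
    ring
  have h1 : dyadicBilin T x x ≠ 0 := by
    intro h0; rw [h0, zero_mul] at e2; exact hD0 e2.symm
  have h2 : dyadicBilin T ((-k) • x + (1 : ℤ_[2]) • y) ((-k) • x + (1 : ℤ_[2]) • y) ≠ 0 := by
    intro h0; rw [h0, mul_zero] at e2; exact hD0 e2.symm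
  have hv := PadicInt.valuation_mul h1 h2
  rw [e2] at hv
  refine ⟨1, 0, -k, 1, ?_, ?_, h2, ?_⟩
  · simp only [dB_add_left, dB_add_right, dB_smul_left, dB_smul_right, hc, hk]
    ring
  · rwa [e1]
  · rw [e1]; omega

theorem planeGood_even (hT : T.IsSymm) (x y : Fin 3 → ℤ_[2]) (D d α γ : ℤ_[2])
    (hD : D = dyadicBilin T x x * dyadicBilin T y y - dyadicBilin T x y ^ 2) (hD0 : D ≠ 0)
    (hd : dyadicBilin T x y = d) (ha : dyadicBilin T x x = 2 * d * α)
    (hb : dyadicBilin T y y = 2 * d * γ) (hα : IsUnit α) : PlaneGood T x y D := by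
  have hc := dB_comm hT y x
  rw [hd] at hc
  have hu : IsUnit (4 * α * γ - 1) := by
    have := (unit_one_add_two_mul (-(2 * α * γ))).neg
    convert this using 1; ring
  have hD' : D = d * d * (4 * α * γ - 1) := by rw [hD, ha, hb, hd]; ring
  have hd0 : d ≠ 0 := by rintro rfl; simp at hD'; exact hD0 hD'
  have h20 : (2 : ℤ_[2]) ≠ 0 := two_ne_zero
  have e1 : dyadicBilin T ((1 : ℤ_[2]) • x + (0 : ℤ_[2]) • y) ((1 : ℤ_[2]) • x + (0 : ℤ_[2]) • y)
      = 2 * d * α := by simp [ha]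
  have e2 : dyadicBilin T ((1 : ℤ_[2]) • x + (-(2 * α)) • y) ((1 : ℤ_[2]) • x + (-(2 * α)) • y)
      = 2 * d * α * (4 * α * γ - 1) := by
    simp only [dB_add_left, dB_add_right, dB_smul_left, dB_smul_right, hc, hd, ha, hb]
    ring
  have n1 : 2 * d ≠ 0 := mul_ne_zero h20 hd0
  have n2 : 2 * d * α ≠ 0 := mul_ne_zero n1 hα.ne_zero
  have vD : D.valuation = d.valuation + d.valuation := by
    rw [hD', PadicInt.valuation_mul (mul_ne_zero hd0 hd0) hu.ne_zero,
      PadicInt.valuation_mul hd0 hd0, val_unit hu]; rfl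
  have v1 : (2 * d * α).valuation = 1 + d.valuation := by
    rw [PadicInt.valuation_mul n1 hα.ne_zero, PadicInt.valuation_mul h20 hd0, val_unit hα,
      val_two]; rfl
  have v2 : (2 * d * α * (4 * α * γ - 1)).valuation = 1 + d.valuation := by
    rw [PadicInt.valuation_mul n2 hu.ne_zero, val_unit hu, v1]; rfl
  refine ⟨1, 0, 1, -(2 * α), ?_, ?_, ?_, ?_⟩
  · simp only [dB_add_left, dB_add_right, dB_smul_left, dB_smul_right, hc, hd, ha, hb]
    ring
  · rwa [e1]
  · rw [e2]; exact mul_ne_zero n2 hu.ne_zero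
  · rw [e1, e2, v1, v2, vD]; omega

theorem planeGood (hT : T.IsSymm) (x y : Fin 3 → ℤ_[2]) (D : ℤ_[2])
    (hD : D = dyadicBilin T x x * dyadicBilin T y y - dyadicBilin T x y ^ 2) (hD0 : D ≠ 0) :
    PlaneGood T x y D := by
  have hc := dB_comm hT y x
  have hDs : D = dyadicBilin T y y * dyadicBilin T x x - dyadicBilin T y x ^ 2 := by
    rw [hD, hc]; ring
  by_cases h1 : dyadicBilin T x x ∣ dyadicBilin T x y
  · exact planeGood_diag hT x y D hD hD0 h1
  by_cases h2 : dyadicBilin T y y ∣ dyadicBilin T x y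
  · exact (planeGood_diag hT y x D hDs hD0 (by rwa [hc])).swap
  obtain ⟨α, hα⟩ := two_mul_dvd_of_not_dvd h1
  obtain ⟨γ, hγ⟩ := two_mul_dvd_of_not_dvd h2
  by_cases uα : IsUnit α
  · exact planeGood_even hT x y D _ α γ hD hD0 rfl hα hγ uα
  by_cases uγ : IsUnit γ
  · exact (planeGood_even hT y x D _ γ α hDs hD0 hc hγ hα uγ).swap
  obtain ⟨α', rfl⟩ := two_dvd_of_not_unit uα
  obtain ⟨γ', rfl⟩ := two_dvd_of_not_unit uγ
  set d := dyadicBilin T x y with hd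
  have hu := unit_one_add_two_mul (2 * γ')
  obtain ⟨w, hw⟩ := hu.exists_right_inv
  have uw : IsUnit w := IsUnit.of_mul_eq_one _ ((mul_comm _ _).trans hw)
  have hu2 := unit_one_add_two_mul (α' + γ')
  apply PlaneGood.shear
  refine planeGood_even hT (x + y) y D (d * (1 + 2 * (2 * γ')))
    ((1 + 2 * (α' + γ')) * w) (2 * γ' * w) ?_ hD0 ?_ ?_ ?_ (hu2.mul uw)
  · simp only [dB_add_left, dB_add_right, hc, hD, ← hd]; ring
  · simp only [dB_add_left, ← hd, hγ]; ring
  · simp only [dB_add_left, dB_add_right, hc, ← hd, hγ, hα]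
    linear_combination (-2 * d * (1 + 2 * (α' + γ'))) * hw
  · rw [hγ]
    linear_combination (-2 * d * (2 * γ')) * hw

/-- Splitting off a rank one orthogonal summand. -/
def SplitGood (T : Matrix (Fin 3) (Fin 3) ℤ_[2]) (G : ℤ_[2]) : Prop :=
  ∃ z x y : Fin 3 → ℤ_[2], dyadicBilin T z x = 0 ∧ dyadicBilin T z y = 0 ∧
    dyadicBilin T z z * (dyadicBilin T x x * dyadicBilin T y y - dyadicBilin T x y ^ 2) = G

theorem splitGood_diag (hT : T.IsSymm) (p q r : Fin 3 → ℤ_[2])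
    (h1 : dyadicBilin T p p ∣ dyadicBilin T p q) (h2 : dyadicBilin T p p ∣ dyadicBilin T p r) :
    SplitGood T (dyadicBilin T p p * dyadicBilin T q q * dyadicBilin T r r
      + 2 * dyadicBilin T p q * dyadicBilin T p r * dyadicBilin T q r
      - dyadicBilin T p p * dyadicBilin T q r ^ 2 - dyadicBilin T q q * dyadicBilin T p r ^ 2
      - dyadicBilin T r r * dyadicBilin T p q ^ 2) := by
  obtain ⟨k, hk⟩ := h1
  obtain ⟨l, hl⟩ := h2
  have c1 := dB_comm hT q p
  have c2 := dB_comm hT r p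
  refine ⟨p, q - k • p, r - l • p, ?_, ?_, ?_⟩
  · simp only [dB_sub_right, dB_smul_right, hk]; ring
  · simp only [dB_sub_right, dB_smul_right, hl]; ring
  · simp only [dB_sub_right, dB_smul_right, dB_sub_left, dB_smul_left, c1, c2, hk, hl]; ring

theorem splitGood_even (hT : T.IsSymm) (p q r : Fin 3 → ℤ_[2])
    (h1 : ∃ c, dyadicBilin T p p = 2 * dyadicBilin T p q * c)
    (h2 : ∃ c, dyadicBilin T q q = 2 * dyadicBilin T p q * c)
    (h3 : dyadicBilin T p q ∣ dyadicBilin T p r) (h4 : dyadicBilin T p q ∣ dyadicBilin T q r) :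
    SplitGood T (dyadicBilin T p p * dyadicBilin T q q * dyadicBilin T r r
      + 2 * dyadicBilin T p q * dyadicBilin T p r * dyadicBilin T q r
      - dyadicBilin T p p * dyadicBilin T q r ^ 2 - dyadicBilin T q q * dyadicBilin T p r ^ 2
      - dyadicBilin T r r * dyadicBilin T p q ^ 2) := by
  obtain ⟨α, ha⟩ := h1
  obtain ⟨γ, hb⟩ := h2
  obtain ⟨e, he⟩ := h3
  obtain ⟨f, hf⟩ := h4
  have c1 := dB_comm hT q p
  have c2 := dB_comm hT r p
  have c3 := dB_comm hT r q
  have hu : IsUnit (4 * α * γ - 1) := by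
    have := (unit_one_add_two_mul (-(2 * α * γ))).neg
    convert this using 1; ring
  obtain ⟨w, hw⟩ := hu.exists_right_inv
  set d := dyadicBilin T p q with hd
  set c := dyadicBilin T r r with hcc
  have o1 : dyadicBilin T (r - (w * (2 * γ * e - f)) • p - (w * (2 * α * f - e)) • q) p = 0 := by
    simp only [dB_sub_left, dB_smul_left, c1, c2, ha, he]
    linear_combination (-d * e) * hw
  have o2 : dyadicBilin T (r - (w * (2 * γ * e - f)) • p - (w * (2 * α * f - e)) • q) q = 0 := by
    simp only [dB_sub_left, dB_smul_left, c3, ← hd, hb, hf]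
    linear_combination (-d * f) * hw
  refine ⟨r - (w * (2 * γ * e - f)) • p - (w * (2 * α * f - e)) • q, p, q, o1, o2, ?_⟩
  rw [dB_sub_right, dB_sub_right, dB_smul_right, dB_smul_right, o1, o2]
  simp only [dB_sub_left, dB_smul_left, ha, hb, he, hf, ← hd, ← hcc]
  linear_combination (-d ^ 2 * (d * e * (2 * γ * e - f) + d * f * (2 * α * f - e))) * hw

theorem dB_single (i j : Fin 3) :
    dyadicBilin T (Pi.single i 1) (Pi.single j 1) = T i j := by
  simp [dyadicBilin]

theorem splitGood_det (hT : T.IsSymm) : SplitGood T T.det := by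
  obtain ⟨⟨i, j⟩, hij⟩ := Finite.exists_max (fun k : Fin 3 × Fin 3 => ‖T k.1 k.2‖)
  have hdvd : ∀ k l, T i j ∣ T k l := by
    intro k l
    rcases ValuationRing.dvd_total (T i j) (T k l) with h | ⟨c, hc⟩
    · exact h
    · by_cases hcu : IsUnit c
      · obtain ⟨w, hw⟩ := hcu.exists_right_inv
        exact ⟨w, by rw [hc]; linear_combination (-T k l) * hw⟩
      · have h1 := hij (k, l)
        simp only at h1
        rw [hc, norm_mul] at h1
        have h2 := PadicInt.not_isUnit_iff.1 hcu
        have h3 : ‖T k l‖ = 0 := by nlinarith [norm_nonneg (T k l)]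
        rw [norm_eq_zero] at h3
        rw [h3]; exact dvd_zero _
  have key : ∃ p q r : Fin 3, p ≠ q ∧ p ≠ r ∧ q ≠ r ∧ ((T p p ∣ T p q ∧ T p p ∣ T p r) ∨
      ((∃ c, T p p = 2 * T p q * c) ∧ (∃ c, T q q = 2 * T p q * c) ∧ T p q ∣ T p r ∧
        T p q ∣ T q r)) := by
    by_cases hdiag : ∃ k, T k k ∣ T i j
    · obtain ⟨k, hk⟩ := hdiag
      have : ∃ q r : Fin 3, k ≠ q ∧ k ≠ r ∧ q ≠ r := by clear hk; revert k; decide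
      obtain ⟨q, r, h1, h2, h3⟩ := this
      exact ⟨k, q, r, h1, h2, h3, Or.inl ⟨hk.trans (hdvd _ _), hk.trans (hdvd _ _)⟩⟩
    · push Not at hdiag
      have hne : i ≠ j := by
        rintro rfl; exact hdiag i dvd_rfl
      have : ∃ r : Fin 3, i ≠ r ∧ j ≠ r := by
        clear hdiag hdvd hij; revert i j; decide
      obtain ⟨r, h1, h2⟩ := this
      exact ⟨i, j, r, hne, h1, h2, Or.inr ⟨two_mul_dvd_of_not_dvd (hdiag i),
        two_mul_dvd_of_not_dvd (hdiag j), hdvd _ _, hdvd _ _⟩⟩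
  obtain ⟨p, q, r, hpq, hpr, hqr, h⟩ := key
  have hdet : T.det = T p p * T q q * T r r + 2 * T p q * T p r * T q r - T p p * T q r ^ 2
      - T q q * T p r ^ 2 - T r r * T p q ^ 2 := by
    have s1 := hT.apply 0 1
    have s2 := hT.apply 0 2
    have s3 := hT.apply 1 2
    rw [det_fin_three]
    fin_cases p <;> fin_cases q <;> first | exact absurd rfl hpq | skip
    all_goals fin_cases r <;> first | exact absurd rfl hpr | exact absurd rfl hqr | skip
    all_goals simp only [Fin.zero_eta, Fin.mk_one, Fin.reduceFinMk, s1, s2, s3]; ring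
  rw [hdet]
  rcases h with ⟨h1, h2⟩ | ⟨h1, h2, h3, h4⟩
  · have := splitGood_diag hT (Pi.single p 1) (Pi.single q 1) (Pi.single r 1)
    simp only [dB_single] at this
    exact this h1 h2
  · have := splitGood_even hT (Pi.single p 1) (Pi.single q 1) (Pi.single r 1)
    simp only [dB_single] at this
    exact this h1 h2 h3 h4

/-- An orthogonal system of nonisotropic lattice vectors with controlled norms. -/
theorem exists_orthogonal (hT : T.IsSymm) (hdet : T.det ≠ 0) :
    ∃ z x y : Fin 3 → ℤ_[2], dyadicBilin T z x = 0 ∧ dyadicBilin T z y = 0 ∧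
      dyadicBilin T x y = 0 ∧ dyadicBilin T z z ≠ 0 ∧ dyadicBilin T x x ≠ 0 ∧
      dyadicBilin T y y ≠ 0 ∧
      4 * (dyadicBilin T z z).valuation + 2 * (dyadicBilin T x x).valuation
        + (dyadicBilin T y y).valuation ≤ 4 * T.det.valuation + 3 := by
  obtain ⟨z, x, y, h1, h2, h3⟩ := splitGood_det hT
  have hz : dyadicBilin T z z ≠ 0 := by
    intro h; rw [h, zero_mul] at h3; exact hdet h3.symm
  have hD : dyadicBilin T x x * dyadicBilin T y y - dyadicBilin T x y ^ 2 ≠ 0 := by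
    intro h; rw [h, mul_zero] at h3; exact hdet h3.symm
  obtain ⟨p, q, r, s, g1, g2, g3, g4⟩ := planeGood hT x y _ rfl hD
  refine ⟨z, p • x + q • y, r • x + s • y, ?_, ?_, g1, hz, g2, g3, ?_⟩
  · simp [dB_add_right, dB_smul_right, h1, h2]
  · simp [dB_add_right, dB_smul_right, h1, h2]
  · rw [← h3, PadicInt.valuation_mul hz hD]; omega

end Lattice

/-! ### Part 2: writing isometries as products of reflections -/

section Reflections

variable {T : Matrix (Fin 3) (Fin 3) ℤ_[2]}

/-- The bilinear form over `ℚ₂`. -/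
def bq (T : Matrix (Fin 3) (Fin 3) ℤ_[2]) : LinearMap.BilinForm ℚ_[2] (Fin 3 → ℚ_[2]) :=
  Matrix.toBilin' (T.map fun t : ℤ_[2] => (t : ℚ_[2]))

theorem bq_apply (x y : Fin 3 → ℚ_[2]) :
    bq T x y = x ⬝ᵥ (T.map fun t : ℤ_[2] => (t : ℚ_[2])).mulVec y :=
  Matrix.toBilin'_apply' _ _ _

theorem bq_comm (hT : T.IsSymm) (x y : Fin 3 → ℚ_[2]) : bq T x y = bq T y x := by
  have h : (T.map fun t : ℤ_[2] => (t : ℚ_[2])).IsSymm := hT.map _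
  rw [bq_apply, bq_apply, dotProduct_mulVec, ← mulVec_transpose, h.eq, dotProduct_comm]

/-- Coercion of integral vectors. -/
def toQ (b : Fin 3 → ℤ_[2]) : Fin 3 → ℚ_[2] := fun i => (b i : ℚ_[2])

theorem bq_toQ (x y : Fin 3 → ℤ_[2]) : bq T (toQ x) (toQ y) = (dyadicBilin T x y : ℚ_[2]) := by
  rw [bq_apply]
  simp [dyadicBilin, dotProduct, mulVec, Fin.sum_univ_three, toQ]

/-- The reflection as a linear map. -/
def tauL (T : Matrix (Fin 3) (Fin 3) ℤ_[2]) (u : Fin 3 → ℚ_[2]) :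
    (Fin 3 → ℚ_[2]) →ₗ[ℚ_[2]] (Fin 3 → ℚ_[2]) :=
  LinearMap.id - (2 / bq T u u) • (bq T u).smulRight u

theorem tauL_apply (u x : Fin 3 → ℚ_[2]) :
    tauL T u x = x - (2 * bq T u x / bq T u u) • u := by
  simp only [tauL, LinearMap.sub_apply, LinearMap.id_apply, LinearMap.smul_apply,
    LinearMap.smulRight_apply, smul_smul]
  congr 2; ring

theorem dyadicReflection_eq (b : Fin 3 → ℤ_[2]) (x : Fin 3 → ℚ_[2]) :
    dyadicReflection T b x = tauL T (toQ b) x := by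
  rw [tauL_apply, bq_apply, bq_apply]; rfl

theorem tauL_tauL (u x : Fin 3 → ℚ_[2]) (hu : bq T u u ≠ 0) :
    tauL T u (tauL T u x) = x := by
  have h2 : 2 * bq T u u / bq T u u = 2 := by field_simp
  simp only [tauL_apply, map_sub, map_smul, h2]
  module

theorem tauL_isom (hT : T.IsSymm) (u x y : Fin 3 → ℚ_[2]) (hu : bq T u u ≠ 0) :
    bq T (tauL T u x) (tauL T u y) = bq T x y := by
  simp only [tauL_apply, map_sub, map_smul, smul_eq_mul, LinearMap.sub_apply,
    LinearMap.smul_apply, bq_comm hT x u]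
  field_simp; ring

theorem tauL_of_ortho (u x : Fin 3 → ℚ_[2]) (h : bq T u x = 0) : tauL T u x = x := by
  simp [tauL_apply, h]

theorem tauL_self (u : Fin 3 → ℚ_[2]) (hu : bq T u u ≠ 0) : tauL T u u = -u := by
  rw [tauL_apply]
  have : 2 * bq T u u / bq T u u = 2 := by field_simp
  rw [this]; module

/-- Being an isometry. -/
def IsomQ (T : Matrix (Fin 3) (Fin 3) ℤ_[2])
    (f : (Fin 3 → ℚ_[2]) →ₗ[ℚ_[2]] (Fin 3 → ℚ_[2])) : Prop :=
  ∀ x y, bq T (f x) (f y) = bq T x y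

/-- Being a product of integral reflections with total valuation at most `c`. -/
def Dec (T : Matrix (Fin 3) (Fin 3) ℤ_[2])
    (f : (Fin 3 → ℚ_[2]) →ₗ[ℚ_[2]] (Fin 3 → ℚ_[2])) (c : ℕ) : Prop :=
  ∃ l : List (Fin 3 → ℤ_[2]), (∀ b ∈ l, dyadicBilin T b b ≠ 0) ∧
    (l.map fun b => (dyadicBilin T b b).valuation).sum ≤ c ∧
    ∀ x, f x = (l.map (dyadicReflection T)).prod x

theorem Dec.mono {f : (Fin 3 → ℚ_[2]) →ₗ[ℚ_[2]] (Fin 3 → ℚ_[2])} {c d : ℕ} (h : Dec T f c)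
    (hcd : c ≤ d) : Dec T f d := by
  obtain ⟨l, h1, h2, h3⟩ := h
  exact ⟨l, h1, h2.trans hcd, h3⟩

theorem dec_id : Dec T LinearMap.id 0 := ⟨[], by simp, by simp, fun x => rfl⟩

theorem ne_toQ {b : Fin 3 → ℤ_[2]} (hb : dyadicBilin T b b ≠ 0) : bq T (toQ b) (toQ b) ≠ 0 := by
  rw [bq_toQ]; exact PadicInt.coe_ne_zero.2 hb

theorem Dec.of_tau {f : (Fin 3 → ℚ_[2]) →ₗ[ℚ_[2]] (Fin 3 → ℚ_[2])} {c : ℕ}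
    (b : Fin 3 → ℤ_[2]) (hb : dyadicBilin T b b ≠ 0) (h : Dec T (tauL T (toQ b) ∘ₗ f) c) :
    Dec T f (c + (dyadicBilin T b b).valuation) := by
  obtain ⟨l, h1, h2, h3⟩ := h
  refine ⟨b :: l, ?_, ?_, ?_⟩
  · intro b' hb'
    rcases List.mem_cons.1 hb' with rfl | h
    · exact hb
    · exact h1 _ h
  · simp only [List.map_cons, List.sum_cons]; omega
  · intro x
    rw [List.map_cons, List.prod_cons]
    change f x = dyadicReflection T b ((l.map (dyadicReflection T)).prod x)
    rw [← h3, dyadicReflection_eq, LinearMap.comp_apply, tauL_tauL _ _ (ne_toQ hb)]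

theorem IsomQ.tau (hT : T.IsSymm) {f : (Fin 3 → ℚ_[2]) →ₗ[ℚ_[2]] (Fin 3 → ℚ_[2])}
    (hf : IsomQ T f) (u : Fin 3 → ℚ_[2]) (hu : bq T u u ≠ 0) : IsomQ T (tauL T u ∘ₗ f) := by
  intro x y
  rw [LinearMap.comp_apply, LinearMap.comp_apply, tauL_isom hT _ _ _ hu, hf]

theorem val_split {x y z : ℚ_[2]} (h : x + y = z) (hz : z ≠ 0) :
    (x ≠ 0 ∧ x.valuation ≤ z.valuation) ∨ (y ≠ 0 ∧ y.valuation ≤ z.valuation) := by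
  subst h
  by_cases hx : x = 0
  · subst hx; right; simpa using hz
  by_cases hy : y = 0
  · subst hy; left; simpa using hx
  rcases min_le_iff.1 (Padic.le_valuation_add hz) with h | h
  · exact Or.inl ⟨hx, h⟩
  · exact Or.inr ⟨hy, h⟩

theorem valQ_two : (2 : ℚ_[2]).valuation = 1 := by
  have := Padic.valuation_p (p := 2)
  exact_mod_cast this

/-- One step of the Cartan-Dieudonné procedure. -/
theorem step (hT : T.IsSymm) {f : (Fin 3 → ℚ_[2]) →ₗ[ℚ_[2]] (Fin 3 → ℚ_[2])} (hf : IsomQ T f)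
    (e a : Fin 3 → ℤ_[2]) (he : dyadicBilin T e e ≠ 0) (d : ℕ)
    (ha : (2 : ℚ_[2]) ^ d • f (toQ e) = toQ a) :
    ∃ (u : Fin 3 → ℤ_[2]) (g : (Fin 3 → ℚ_[2]) →ₗ[ℚ_[2]] (Fin 3 → ℚ_[2])) (ε : ℚ_[2]),
      dyadicBilin T u u ≠ 0 ∧
      (dyadicBilin T u u).valuation ≤ 2 * d + (dyadicBilin T e e).valuation + 2 ∧
      toQ u = (2 : ℚ_[2]) ^ d • (f (toQ e) + ε • toQ e) ∧
      IsomQ T g ∧ g (toQ e) = toQ e ∧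
      (∀ x, bq T (toQ e) x = 0 → g x = tauL T (toQ u) (f x)) ∧
      (∀ c, Dec T g c → Dec T f (c + (2 * d + 2 * (dyadicBilin T e e).valuation + 2))) := by
  have he' := ne_toQ he
  have h20 : (2 : ℚ_[2]) ≠ 0 := two_ne_zero
  have hpow : ((2 : ℚ_[2]) ^ d) ≠ 0 := pow_ne_zero _ h20
  -- the two candidate vectors
  have hu : ∀ ε : ℤ_[2], toQ (a + ((2 : ℤ_[2]) ^ d * ε) • e)
      = (2 : ℚ_[2]) ^ d • (f (toQ e) + (ε : ℚ_[2]) • toQ e) := by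
    intro ε
    rw [smul_add, ha]
    funext i
    have h2c : ((2 : ℤ_[2]) : ℚ_[2]) = 2 := rfl
    simp [toQ, mul_assoc, h2c]
  have hQ : ∀ ε : ℚ_[2], ε ^ 2 = 1 →
      bq T ((2 : ℚ_[2]) ^ d • (f (toQ e) + ε • toQ e)) ((2 : ℚ_[2]) ^ d • (f (toQ e) + ε • toQ e))
      = 2 ^ d * 2 ^ d * 2 * (bq T (toQ e) (toQ e) + ε * bq T (f (toQ e)) (toQ e)) := by
    intro ε hε
    simp only [map_add, map_smul, smul_eq_mul, LinearMap.add_apply, LinearMap.smul_apply,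
      hf (toQ e) (toQ e), bq_comm hT (toQ e) (f (toQ e))]
    linear_combination (2 ^ d * 2 ^ d * bq T (toQ e) (toQ e)) * hε
  have htau : ∀ ε : ℚ_[2], ε ^ 2 = 1 →
      bq T ((2 : ℚ_[2]) ^ d • (f (toQ e) + ε • toQ e)) ((2 : ℚ_[2]) ^ d • (f (toQ e) + ε • toQ e))
        ≠ 0 →
      tauL T ((2 : ℚ_[2]) ^ d • (f (toQ e) + ε • toQ e)) (f (toQ e)) = (-ε) • toQ e := by
    intro ε hε h0
    rw [tauL_apply]
    rw [hQ ε hε] at h0 ⊢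
    have h1 : bq T (toQ e) (toQ e) + ε * bq T (f (toQ e)) (toQ e) ≠ 0 := right_ne_zero_of_mul h0
    have h2 : bq T ((2 : ℚ_[2]) ^ d • (f (toQ e) + ε • toQ e)) (f (toQ e))
        = 2 ^ d * (bq T (toQ e) (toQ e) + ε * bq T (f (toQ e)) (toQ e)) := by
      simp only [map_add, map_smul, smul_eq_mul, LinearMap.add_apply, LinearMap.smul_apply,
        hf (toQ e) (toQ e), bq_comm hT (toQ e) (f (toQ e))]
    rw [h2, smul_smul]
    have h3 : 2 * (2 ^ d * (bq T (toQ e) (toQ e) + ε * bq T (f (toQ e)) (toQ e))) /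
        (2 ^ d * 2 ^ d * 2 * (bq T (toQ e) (toQ e) + ε * bq T (f (toQ e)) (toQ e))) * 2 ^ d
        = (1 : ℚ_[2]) := by
      field_simp
    rw [h3]; module
  have hsum : bq T ((2 : ℚ_[2]) ^ d • (f (toQ e) + (-1 : ℚ_[2]) • toQ e))
        ((2 : ℚ_[2]) ^ d • (f (toQ e) + (-1 : ℚ_[2]) • toQ e))
      + bq T ((2 : ℚ_[2]) ^ d • (f (toQ e) + (1 : ℚ_[2]) • toQ e))
        ((2 : ℚ_[2]) ^ d • (f (toQ e) + (1 : ℚ_[2]) • toQ e))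
      = 2 ^ (2 * d + 2) * bq T (toQ e) (toQ e) := by
    rw [hQ _ (by norm_num), hQ _ (by norm_num)]; ring
  have hz : (2 : ℚ_[2]) ^ (2 * d + 2) * bq T (toQ e) (toQ e) ≠ 0 :=
    mul_ne_zero (pow_ne_zero _ h20) he'
  have hzv : ((2 : ℚ_[2]) ^ (2 * d + 2) * bq T (toQ e) (toQ e)).valuation
      = 2 * d + 2 + (dyadicBilin T e e).valuation := by
    rw [Padic.valuation_mul (pow_ne_zero _ h20) he', Padic.valuation_pow, valQ_two, bq_toQ,
      PadicInt.valuation_coe]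
    push_cast; ring
  rcases val_split hsum hz with ⟨h0, hv⟩ | ⟨h0, hv⟩
  · have hm := hu (-1)
    push_cast at hm
    have ht := htau (-1) (by norm_num) h0
    rw [← hm, bq_toQ, PadicInt.valuation_coe, hzv] at hv
    rw [← hm] at h0 ht
    have hn : dyadicBilin T (a + ((2 : ℤ_[2]) ^ d * (-1)) • e) (a + ((2 : ℤ_[2]) ^ d * (-1)) • e)
        ≠ 0 := by
      rw [bq_toQ] at h0; exact PadicInt.coe_ne_zero.1 h0
    refine ⟨_, tauL T (toQ (a + ((2 : ℤ_[2]) ^ d * (-1)) • e)) ∘ₗ f, -1, hn, by omega, hm,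
      hf.tau hT _ h0, ?_, fun x _ => rfl, ?_⟩
    · rw [LinearMap.comp_apply, ht]; simp
    · intro c hc
      exact (hc.of_tau _ hn).mono (by omega)
  · have hm := hu 1
    push_cast at hm
    have ht := htau 1 (by norm_num) h0
    rw [← hm, bq_toQ, PadicInt.valuation_coe, hzv] at hv
    rw [← hm] at h0 ht
    have hn : dyadicBilin T (a + ((2 : ℤ_[2]) ^ d * 1) • e) (a + ((2 : ℤ_[2]) ^ d * 1) • e)
        ≠ 0 := by
      rw [bq_toQ] at h0; exact PadicInt.coe_ne_zero.1 h0
    have hi := hf.tau hT _ h0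
    refine ⟨_, tauL T (toQ e) ∘ₗ tauL T (toQ (a + ((2 : ℤ_[2]) ^ d * 1) • e)) ∘ₗ f, 1, hn,
      by omega, hm, hi.tau hT _ he', ?_, ?_, ?_⟩
    · rw [LinearMap.comp_apply, LinearMap.comp_apply, ht, map_smul, tauL_self _ he']; simp
    · intro x hx
      rw [LinearMap.comp_apply, LinearMap.comp_apply]
      apply tauL_of_ortho
      have h5 := hi (toQ e) x
      rw [LinearMap.comp_apply, LinearMap.comp_apply, ht, hx] at h5
      simpa using h5
    · intro c hc
      exact ((hc.of_tau _ he).of_tau _ hn).mono (by omega)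

theorem span_of_ortho (hT : T.IsSymm) (z x y : Fin 3 → ℚ_[2]) (h1 : bq T z x = 0)
    (h2 : bq T z y = 0) (h3 : bq T x y = 0) (hz : bq T z z ≠ 0) (hx : bq T x x ≠ 0)
    (hy : bq T y y ≠ 0) (v : Fin 3 → ℚ_[2]) : ∃ a b c : ℚ_[2], v = a • z + b • x + c • y := by
  have c1 := bq_comm hT x z
  have c2 := bq_comm hT y z
  have c3 := bq_comm hT y x
  have hli : LinearIndependent ℚ_[2] ![z, x, y] := by
    apply LinearMap.BilinForm.linearIndependent_of_iIsOrtho (B := bq T)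
    · rw [LinearMap.BilinForm.iIsOrtho_def]
      intro i j hij
      fin_cases i <;> fin_cases j <;> first | exact absurd rfl hij | skip
      all_goals simp [c1, c2, c3, h1, h2, h3]
    · intro i
      fin_cases i <;> simpa
  let bs := basisOfLinearIndependentOfCardEqFinrank hli (by simp)
  have hs := bs.sum_repr v
  rw [Fin.sum_univ_three] at hs
  simp only [bs, coe_basisOfLinearIndependentOfCardEqFinrank] at hs
  exact ⟨_, _, _, hs.symm⟩

theorem last_step (hT : T.IsSymm) (z x y : Fin 3 → ℤ_[2]) (h1 : dyadicBilin T z x = 0)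
    (h2 : dyadicBilin T z y = 0) (h3 : dyadicBilin T x y = 0) (hz : dyadicBilin T z z ≠ 0)
    (hx : dyadicBilin T x x ≠ 0) (hy : dyadicBilin T y y ≠ 0)
    {f : (Fin 3 → ℚ_[2]) →ₗ[ℚ_[2]] (Fin 3 → ℚ_[2])} (hf : IsomQ T f)
    (fz : f (toQ z) = toQ z) (fx : f (toQ x) = toQ x) :
    Dec T f (dyadicBilin T y y).valuation := by
  have q1 : bq T (toQ z) (toQ x) = 0 := by rw [bq_toQ, h1]; rfl
  have q2 : bq T (toQ z) (toQ y) = 0 := by rw [bq_toQ, h2]; rfl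
  have q3 : bq T (toQ x) (toQ y) = 0 := by rw [bq_toQ, h3]; rfl
  have q1' := (bq_comm hT (toQ x) (toQ z)).trans q1
  have nz := ne_toQ hz
  have nx := ne_toQ hx
  have ny := ne_toQ hy
  have hsp := span_of_ortho hT _ _ _ q1 q2 q3 nz nx ny
  obtain ⟨a, b, c, habc⟩ := hsp (f (toQ y))
  have e1 := hf (toQ z) (toQ y)
  rw [fz, habc] at e1
  simp only [map_add, map_smul, q1, q2, smul_eq_mul, mul_zero, add_zero, mul_eq_zero, nz,
    or_false] at e1
  have e2 := hf (toQ x) (toQ y)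
  rw [fx, habc] at e2
  simp only [map_add, map_smul, q1', q3, smul_eq_mul, mul_zero, add_zero, zero_add, mul_eq_zero,
    nx, or_false] at e2
  subst e1 e2
  simp only [zero_smul, zero_add] at habc
  have e3 := hf (toQ y) (toQ y)
  rw [habc] at e3
  simp only [map_smul, LinearMap.smul_apply, smul_eq_mul] at e3
  have hc : (c - 1) * (c + 1) = 0 := by
    have : bq T (toQ y) (toQ y) * ((c - 1) * (c + 1)) = 0 := by linear_combination e3
    exact (mul_eq_zero.1 this).resolve_left ny
  have hext : ∀ g : (Fin 3 → ℚ_[2]) →ₗ[ℚ_[2]] (Fin 3 → ℚ_[2]), g (toQ z) = toQ z →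
      g (toQ x) = toQ x → g (toQ y) = toQ y → g = LinearMap.id := by
    intro g g1 g2 g3
    refine LinearMap.ext fun v => ?_
    obtain ⟨a, b, c, rfl⟩ := hsp v
    simp only [map_add, map_smul, g1, g2, g3, LinearMap.id_apply]
  rcases mul_eq_zero.1 hc with h | h
  · have hc1 : c = 1 := by linear_combination h
    rw [hext f fz fx (by rw [habc, hc1, one_smul])]
    exact dec_id.mono (Nat.zero_le _)
  · have hc1 : c = -1 := by linear_combination h
    have : tauL T (toQ y) ∘ₗ f = LinearMap.id := by
      apply hext
      · rw [LinearMap.comp_apply, fz, tauL_of_ortho _ _ ((bq_comm hT _ _).trans q2)]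
      · rw [LinearMap.comp_apply, fx, tauL_of_ortho _ _ ((bq_comm hT _ _).trans q3)]
      · rw [LinearMap.comp_apply, habc, hc1, map_smul, tauL_self _ ny]; simp
    have h0 : Dec T (tauL T (toQ y) ∘ₗ f) 0 := by rw [this]; exact dec_id
    exact (h0.of_tau y hy).mono (by omega)

theorem tau_integral (u x : Fin 3 → ℤ_[2]) (hu : dyadicBilin T u u ≠ 0) (m : ℕ)
    (hm : (dyadicBilin T u u).valuation ≤ m + 1) :
    ∃ a : Fin 3 → ℤ_[2], (2 : ℚ_[2]) ^ m • tauL T (toQ u) (toQ x) = toQ a := by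
  have h20 : (2 : ℚ_[2]) ≠ 0 := two_ne_zero
  have hk : ‖(2 : ℚ_[2]) ^ (m + 1) * bq T (toQ u) (toQ x) / bq T (toQ u) (toQ u)‖ ≤ 1 := by
    by_cases h0 : dyadicBilin T u x = 0
    · simp [bq_toQ, h0]
    · rw [Padic.norm_le_one_iff_val_nonneg, bq_toQ, bq_toQ, div_eq_mul_inv]
      have n1 : (dyadicBilin T u x : ℚ_[2]) ≠ 0 := PadicInt.coe_ne_zero.2 h0
      have n2 : (dyadicBilin T u u : ℚ_[2]) ≠ 0 := PadicInt.coe_ne_zero.2 hu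
      rw [Padic.valuation_mul (mul_ne_zero (pow_ne_zero _ h20) n1) (inv_ne_zero n2),
        Padic.valuation_mul (pow_ne_zero _ h20) n1, Padic.valuation_inv, Padic.valuation_pow,
        valQ_two, PadicInt.valuation_coe, PadicInt.valuation_coe]
      push_cast
      omega
  obtain ⟨k, hk'⟩ : ∃ k : ℤ_[2], (k : ℚ_[2])
      = (2 : ℚ_[2]) ^ (m + 1) * bq T (toQ u) (toQ x) / bq T (toQ u) (toQ u) := ⟨⟨_, hk⟩, rfl⟩
  refine ⟨(2 : ℤ_[2]) ^ m • x - k • u, ?_⟩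
  rw [tauL_apply]
  funext i
  simp only [toQ, Pi.smul_apply, Pi.sub_apply, smul_eq_mul, PadicInt.coe_sub, PadicInt.coe_mul,
    PadicInt.coe_pow, hk']
  have h2c : ((2 : ℤ_[2]) : ℚ_[2]) = 2 := rfl
  rw [h2c]
  ring

end Reflections

/-- **Bounded Cartan–Dieudonné over `ℤ₂` in rank 3** (Lemma on lifting to GSpin, `p = 2`).
Let `T` be a nondegenerate symmetric `3 × 3` Gram matrix over `ℤ₂` with `v₂(det T) = N`.
Every isometry `σ ∈ O(L)` (a `ℤ₂`-matrix `S` with unit determinant and `Sᵀ T S = T`) is,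
as an automorphism of `ℚ₂ ^ 3`, a composition of finitely many reflections `τ_{b_j}` in
integral vectors `b_j` with `B(b_j,b_j) ≠ 0` and total valuation
`∑ j, v₂(B(b_j,b_j)) ≤ 5N + 11`. -/
theorem isometry_eq_prod_reflections_bounded_valuation_two
    (T : Matrix (Fin 3) (Fin 3) ℤ_[2]) (hTsymm : T.IsSymm) (hTdet : T.det ≠ 0)
    (N : ℕ) (hN : T.det.valuation = (N : ℤ))
    (S : Matrix (Fin 3) (Fin 3) ℤ_[2]) (hSunit : IsUnit S.det)
    (hSorth : Sᵀ * T * S = T) :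
    ∃ (n : ℕ) (b : Fin n → Fin 3 → ℤ_[2]),
      (∀ j, dyadicBilin T (b j) (b j) ≠ 0) ∧
      (∑ j, (dyadicBilin T (b j) (b j)).valuation) ≤ 5 * N + 11 ∧
      ∀ x : Fin 3 → ℚ_[2],
        (S.map fun t : ℤ_[2] => (t : ℚ_[2])).mulVec x =
          (List.ofFn fun j => dyadicReflection T (b j)).prod x := by
  obtain ⟨z, x, y, h1, h2, h3, hz, hx, hy, hle⟩ := exists_orthogonal hTsymm hTdet
  have hN' : T.det.valuation = N := by exact_mod_cast hN
  rw [hN'] at hle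
  let f : (Fin 3 → ℚ_[2]) →ₗ[ℚ_[2]] (Fin 3 → ℚ_[2]) :=
    Matrix.mulVecLin (S.map fun t : ℤ_[2] => (t : ℚ_[2]))
  have hfapp : ∀ v, f v = (S.map fun t : ℤ_[2] => (t : ℚ_[2])).mulVec v := fun v => rfl
  have hSq : (S.map fun t : ℤ_[2] => (t : ℚ_[2]))ᵀ * (T.map fun t : ℤ_[2] => (t : ℚ_[2])) *
      (S.map fun t : ℤ_[2] => (t : ℚ_[2])) = T.map fun t : ℤ_[2] => (t : ℚ_[2]) := by
    have := congrArg (fun M : Matrix (Fin 3) (Fin 3) ℤ_[2] => M.map (PadicInt.Coe.ringHom (p := 2)))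
      hSorth
    simp only [Matrix.map_mul] at this
    exact this
  have hf : IsomQ T f := by
    intro v w
    rw [bq_apply, bq_apply, hfapp, hfapp]
    conv_rhs => rw [← hSq]
    rw [← mulVec_mulVec, ← mulVec_mulVec, dotProduct_mulVec v, ← mulVec_transpose,
      transpose_transpose]
  have hint : ∀ v : Fin 3 → ℤ_[2], f (toQ v) = toQ (S.mulVec v) := by
    intro v
    rw [hfapp]
    funext i
    simp [toQ, mulVec, dotProduct, Fin.sum_univ_three]
  have q1 : bq T (toQ z) (toQ x) = 0 := by rw [bq_toQ, h1]; rfl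
  have q1' := (bq_comm hTsymm (toQ x) (toQ z)).trans q1
  -- first step
  obtain ⟨u, g, ε, hu, hvu, -, hg, gz, gperp, gdec⟩ :=
    step hTsymm hf z (S.mulVec z) hz 0 (by rw [pow_zero, one_smul, hint])
  -- second step
  obtain ⟨a, ha⟩ := tau_integral u (S.mulVec x) hu ((dyadicBilin T z z).valuation + 1) (by omega)
  rw [← hint, ← gperp _ q1] at ha
  obtain ⟨u2, g2, ε2, hu2, -, hu2e, hg2, g2x, g2perp, g2dec⟩ := step hTsymm hg x a hx _ ha
  have g2z : g2 (toQ z) = toQ z := by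
    rw [g2perp _ q1', gz]
    apply tauL_of_ortho
    have := hg (toQ x) (toQ z)
    rw [gz, q1'] at this
    rw [hu2e]
    simp [this, q1']
  -- third step
  have hd := gdec _ (g2dec _ (last_step hTsymm z x y h1 h2 h3 hz hx hy hg2 g2z g2x))
  obtain ⟨l, l1, l2, l3⟩ := hd
  refine ⟨l.length, fun j => l.get j, fun j => l1 _ (List.get_mem _ _), ?_, ?_⟩
  · have : (∑ j : Fin l.length, (dyadicBilin T (l.get j) (l.get j)).valuation)
        = (l.map fun b => (dyadicBilin T b b).valuation).sum := by
      rw [← List.sum_ofFn]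
      congr 1
      rw [← Function.comp_def (fun b => (dyadicBilin T b b).valuation) l.get, ← List.map_ofFn,
        List.ofFn_get]
    rw [this]
    omega
  · intro v
    have : (List.ofFn fun j => dyadicReflection T (l.get j)) = l.map (dyadicReflection T) := by
      rw [← Function.comp_def (dyadicReflection T) l.get, ← List.map_ofFn, List.ofFn_get]
    rw [this, ← l3, hfapp]

end
end
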